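/- Let α ∈ (0,1) and let g : ℝ^d → ℝ^d satisfy a global Lipschitz condition with constant L > 0. Then the integral equation formulation of the autonomous Caputo fractional differential equation of order α generates a semi-dynamical system on 𝔠: for each τ ≥ 0 the operator (T_τ f)(θ) = f(τ + θ) + (1/Γ(α)) ∫₀^τ (τ + θ − s)^{α−1} g(x_f(s)) ds is a continuous map from 𝔠 to 𝔠, T_0 is the identity, and T_{σ+τ} = T_σ ∘ T_τ for all σ, τ ≥ 0. -/

import Mathlib

open Real MeasureTheory Set

/-- `sup_{t∈[0,n]} ‖f(t) − h(t)‖`. -/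
noncomputable def supDist {d : ℕ} (n : ℝ)
    (f h : ℝ → EuclideanSpace ℝ (Fin d)) : ℝ :=
  ⨆ t : Set.Icc (0:ℝ) n, ‖f t.1 - h t.1‖

/-- `ρ_n(f,h) = sup_{t∈[0,n]}‖f(t)−h(t)‖ / (1 + sup_{t∈[0,n]}‖f(t)−h(t)‖)`. -/
noncomputable def rhoN {d : ℕ} (n : ℝ)
    (f h : ℝ → EuclideanSpace ℝ (Fin d)) : ℝ :=
  supDist n f h / (1 + supDist n f h)

/-- The metric `ρ(f,h) = ∑_{n=1}^∞ 2^{−n} ρ_n(f,h)` of uniform convergence on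
compact subsets of `ℝ₊`. -/
noncomputable def rhoMetric {d : ℕ}
    (f h : ℝ → EuclideanSpace ℝ (Fin d)) : ℝ :=
  ∑' n : ℕ, (1 / 2 ^ (n + 1)) * rhoN ((n : ℝ) + 1) f h

/-- The operator `(T_τ f)(θ) = f(τ+θ) + (1/Γ(α)) ∫₀^τ (τ+θ−s)^{α−1} g(x_f(s)) ds`,
where `sol f = x_f` is the solution operator. -/
noncomputable def semigroupOp {d : ℕ} (α : ℝ)
    (g : EuclideanSpace ℝ (Fin d) → EuclideanSpace ℝ (Fin d))
    (sol : (ℝ → EuclideanSpace ℝ (Fin d)) → ℝ → EuclideanSpace ℝ (Fin d))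
    (τ : ℝ) (f : ℝ → EuclideanSpace ℝ (Fin d)) :
    ℝ → EuclideanSpace ℝ (Fin d) :=
  fun θ => f (τ + θ) + (1 / Real.Gamma α) •
    ∫ s in (0:ℝ)..τ, ((τ + θ - s) ^ (α - 1)) • g (sol f s)

lemma kern_int {α : ℝ} (hα : 0 < α) (t a b : ℝ) :
    IntervalIntegrable (fun s : ℝ => (t - s) ^ (α - 1)) volume a b := by
  have h := (intervalIntegral.intervalIntegrable_rpow' (a := t - a) (b := t - b)
    (r := α - 1) (by linarith)).comp_sub_left t
  simpa using h

lemma kern_smul_int {E : Type*} [NormedAddCommGroup E] [NormedSpace ℝ E]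
    {α : ℝ} (hα : 0 < α) (t : ℝ) {a b : ℝ} (ha : 0 ≤ a) (hb : 0 ≤ b) {u : ℝ → E}
    (hu : ContinuousOn u (Ici 0)) :
    IntervalIntegrable (fun s : ℝ => (t - s) ^ (α - 1) • u s) volume a b := by
  apply (kern_int hα t a b).smul_continuousOn
  apply hu.mono
  intro s hs
  exact le_trans (le_min ha hb) hs.1

lemma gamma_bound {α l t : ℝ} (hα : 0 < α) (hl : 0 < l) (ht : 0 ≤ t) :
    ∫ s in (0:ℝ)..t, (t - s) ^ (α - 1) * exp (-(l * (t - s))) ≤ (1 / l) ^ α * Real.Gamma α := by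
  rw [intervalIntegral.integral_comp_sub_left (fun r => r ^ (α - 1) * exp (-(l * r))) t]
  rw [sub_self, sub_zero, intervalIntegral.integral_of_le ht,
    ← Real.integral_rpow_mul_exp_neg_mul_Ioi hα hl]
  apply setIntegral_mono_set
  · have := integrableOn_rpow_mul_exp_neg_mul_rpow (p := 1) (s := α - 1) (b := l)
      (by linarith) one_pos hl
    simpa using this
  · filter_upwards [ae_restrict_mem measurableSet_Ioi] with x hx
    exact mul_nonneg (rpow_nonneg (le_of_lt hx) _) (exp_pos _).le
  · exact (Ioc_subset_Ioi_self).eventuallyLE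

lemma sing_gronwall {α L a N : ℝ} (hα : 0 < α) (hL : 0 < L) (ha : 0 ≤ a) (hN : 0 ≤ N)
    {e : ℝ → ℝ} (he : ContinuousOn e (Ici 0))
    (h : ∀ t ∈ Icc (0:ℝ) N, e t ≤ a + (1 / Real.Gamma α) *
      ∫ s in (0:ℝ)..t, (t - s) ^ (α - 1) * (L * e s)) :
    ∀ t ∈ Icc (0:ℝ) N, e t ≤ 2 * a * exp ((2 * L) ^ (1 / α) * t) := by
  set l := (2 * L) ^ (1 / α) with hl
  have hl0 : 0 < l := by positivity
  have hlα : (1 / l) ^ α = 1 / (2 * L) := by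
    rw [one_div, inv_rpow hl0.le, hl, ← rpow_mul (by positivity), one_div_mul_cancel hα.ne',
      rpow_one, one_div]
  have hG : 0 < Real.Gamma α := Real.Gamma_pos_of_pos hα
  have hcont : ContinuousOn (fun t => exp (-(l * t)) * e t) (Icc 0 N) := by
    apply ContinuousOn.mul
    · fun_prop
    · exact he.mono Icc_subset_Ici_self
  obtain ⟨t0, ht0, hmax⟩ := isCompact_Icc.exists_isMaxOn (nonempty_Icc.2 hN) hcont
  set M := exp (-(l * t0)) * e t0 with hM
  have hle : ∀ s ∈ Icc (0:ℝ) N, e s ≤ M * exp (l * s) := by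
    intro s hs
    have h1 : exp (-(l * s)) * e s ≤ M := hmax hs
    have h2 : exp (l * s) * exp (-(l * s)) = 1 := by rw [← exp_add]; simp
    calc e s = (exp (l * s) * exp (-(l * s))) * e s := by rw [h2, one_mul]
      _ = (exp (-(l * s)) * e s) * exp (l * s) := by ring
      _ ≤ _ := by gcongr
  have hMa : M ≤ 2 * a := by
    by_cases hM0 : M ≤ 0
    · linarith
    push Not at hM0
    have h1 := h t0 ht0
    have h2 : ∫ s in (0:ℝ)..t0, (t0 - s) ^ (α - 1) * (L * e s) ≤
        ∫ s in (0:ℝ)..t0, (L * M * exp (l * t0)) *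
          ((t0 - s) ^ (α - 1) * exp (-(l * (t0 - s)))) := by
      apply intervalIntegral.integral_mono_on ht0.1
      · exact kern_smul_int (E := ℝ) hα t0 le_rfl ht0.1 (he.const_smul L)
      · apply IntervalIntegrable.const_mul
        exact kern_smul_int (E := ℝ) hα t0 le_rfl ht0.1
          (u := fun s => exp (-(l * (t0 - s)))) (by fun_prop)
      · intro s hs
        have h3 := hle s ⟨hs.1, hs.2.trans ht0.2⟩
        have h4 : exp (l * s) = exp (l * t0) * exp (-(l * (t0 - s))) := by
          rw [← exp_add]; congr 1; ring
        have h5 : 0 ≤ (t0 - s) ^ (α - 1) := rpow_nonneg (by linarith [hs.2]) _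
        calc (t0 - s) ^ (α - 1) * (L * e s)
            ≤ (t0 - s) ^ (α - 1) * (L * (M * exp (l * s))) := by gcongr
          _ = _ := by rw [h4]; ring
    rw [intervalIntegral.integral_const_mul] at h2
    have h3 := gamma_bound hα hl0 ht0.1
    rw [hlα] at h3
    have h4 : (L * M * exp (l * t0)) *
        ∫ s in (0:ℝ)..t0, (t0 - s) ^ (α - 1) * exp (-(l * (t0 - s))) ≤
        (L * M * exp (l * t0)) * (1 / (2 * L) * Real.Gamma α) := by gcongr
    have h5 : (1 / Real.Gamma α) * ∫ s in (0:ℝ)..t0, (t0 - s) ^ (α - 1) * (L * e s) ≤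
        (1 / Real.Gamma α) * ((L * M * exp (l * t0)) * (1 / (2 * L) * Real.Gamma α)) := by
      gcongr
      exact h2.trans h4
    have h6 : (1 / Real.Gamma α) * ((L * M * exp (l * t0)) * (1 / (2 * L) * Real.Gamma α))
        = M * exp (l * t0) / 2 := by field_simp
    have h7 : e t0 = M * exp (l * t0) := by
      have h2 : exp (l * t0) * exp (-(l * t0)) = 1 := by rw [← exp_add]; simp
      rw [hM]
      calc e t0 = (exp (l * t0) * exp (-(l * t0))) * e t0 := by rw [h2, one_mul]
        _ = _ := by ring
    have h8 : 1 ≤ exp (l * t0) := one_le_exp (mul_nonneg hl0.le ht0.1)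
    nlinarith
  intro t ht
  exact (hle t ht).trans (by gcongr)

lemma diff_bound {E : Type*} [NormedAddCommGroup E] [NormedSpace ℝ E]
    {α L : ℝ} (hα : 0 < α) {g : E → E} (hgc : Continuous g)
    (hg : ∀ x y : E, ‖g x - g y‖ ≤ L * ‖x - y‖) {x y : ℝ → E}
    (hx : ContinuousOn x (Ici 0)) (hy : ContinuousOn y (Ici 0))
    {τ t : ℝ} (hτ : 0 ≤ τ) (hτt : τ ≤ t) :
    ‖(∫ s in (0:ℝ)..τ, (t - s) ^ (α - 1) • g (x s)) -
      ∫ s in (0:ℝ)..τ, (t - s) ^ (α - 1) • g (y s)‖ ≤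
      ∫ s in (0:ℝ)..τ, (t - s) ^ (α - 1) * (L * ‖x s - y s‖) := by
  rw [← intervalIntegral.integral_sub (kern_smul_int (u := fun s => g (x s)) hα t le_rfl hτ (hgc.comp_continuousOn hx))
    (kern_smul_int (u := fun s => g (y s)) hα t le_rfl hτ (hgc.comp_continuousOn hy))]
  apply intervalIntegral.norm_integral_le_of_norm_le hτ
  · refine Filter.Eventually.of_forall fun s hs => ?_
    have h5 : 0 ≤ (t - s) ^ (α - 1) := rpow_nonneg (by linarith [hs.2]) _
    rw [← smul_sub, norm_smul, Real.norm_of_nonneg h5]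
    gcongr
    exact hg _ _
  · exact kern_smul_int (E := ℝ) hα t le_rfl hτ ((hx.sub hy).norm.const_smul L)

lemma stab {E : Type*} [NormedAddCommGroup E] [NormedSpace ℝ E]
    {α L a N : ℝ} (hα : 0 < α) (hL : 0 < L) (hN : 0 ≤ N) {g : E → E} (hgc : Continuous g)
    (hg : ∀ x y : E, ‖g x - g y‖ ≤ L * ‖x - y‖) {f h x y : ℝ → E}
    (hx : ContinuousOn x (Ici 0)) (hy : ContinuousOn y (Ici 0))
    (hxs : ∀ t : ℝ, 0 ≤ t → x t = f t + (1 / Real.Gamma α) •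
      ∫ s in (0:ℝ)..t, ((t - s) ^ (α - 1)) • g (x s))
    (hys : ∀ t : ℝ, 0 ≤ t → y t = h t + (1 / Real.Gamma α) •
      ∫ s in (0:ℝ)..t, ((t - s) ^ (α - 1)) • g (y s))
    (hfh : ∀ t ∈ Icc (0:ℝ) N, ‖f t - h t‖ ≤ a) :
    ∀ t ∈ Icc (0:ℝ) N, ‖x t - y t‖ ≤ 2 * a * exp ((2 * L) ^ (1 / α) * t) := by
  have hG : 0 < Real.Gamma α := Real.Gamma_pos_of_pos hα
  apply sing_gronwall hα hL ((norm_nonneg _).trans (hfh 0 ⟨le_rfl, hN⟩)) hN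
    (e := fun s => ‖x s - y s‖) (hx.sub hy).norm
  intro t ht
  have h1 := diff_bound hα hgc hg hx hy ht.1 le_rfl
  rw [hxs t ht.1, hys t ht.1, add_sub_add_comm, ← smul_sub]
  refine (norm_add_le _ _).trans (add_le_add (hfh t ht) ?_)
  rw [norm_smul, Real.norm_of_nonneg (by positivity)]
  gcongr

lemma cont_op {E : Type*} [NormedAddCommGroup E] [NormedSpace ℝ E]
    {α τ : ℝ} (hα : 0 < α) (hα1 : α < 1) (hτ : 0 ≤ τ) {u : ℝ → E} (hu : ContinuousOn u (Ici 0)) :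
    ContinuousOn (fun θ => ∫ s in (0:ℝ)..τ, (τ + θ - s) ^ (α - 1) • u s) (Ici 0) := by
  intro θ0 hθ0
  apply intervalIntegral.continuousWithinAt_of_dominated_interval
    (bound := fun s => (τ - s) ^ (α - 1) * ‖u s‖)
  · refine Filter.Eventually.of_forall fun θ => ?_
    rw [uIoc_of_le hτ]
    exact (kern_smul_int hα (τ + θ) le_rfl hτ hu).aestronglyMeasurable
  · filter_upwards [self_mem_nhdsWithin] with θ hθ
    filter_upwards [compl_mem_ae_iff.mpr (measure_singleton (μ := volume) τ)] with s hs hs2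
    rw [uIoc_of_le hτ] at hs2
    have hlt : s < τ := lt_of_le_of_ne hs2.2 hs
    have hθ' : (0:ℝ) ≤ θ := hθ
    rw [norm_smul, Real.norm_of_nonneg (rpow_nonneg (by linarith) _)]
    gcongr ?_ * _
    exact rpow_le_rpow_of_nonpos (by linarith) (by linarith) (by linarith)
  · exact kern_smul_int (E := ℝ) hα τ le_rfl hτ hu.norm
  · filter_upwards [compl_mem_ae_iff.mpr (measure_singleton (μ := volume) τ)] with s hs hs2
    rw [uIoc_of_le hτ] at hs2
    have hlt : s < τ := lt_of_le_of_ne hs2.2 hs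
    have hθ' : (0:ℝ) ≤ θ0 := hθ0
    apply ContinuousAt.continuousWithinAt
    apply ContinuousAt.smul _ continuousAt_const
    apply ContinuousAt.rpow_const (by fun_prop)
    left; linarith

lemma split_int {E : Type*} [NormedAddCommGroup E] [NormedSpace ℝ E]
    {α τ σ t : ℝ} (hα : 0 < α) (hτ : 0 ≤ τ) (hσ : 0 ≤ σ) {u : ℝ → E}
    (hu : ContinuousOn u (Ici 0)) :
    ∫ s in (0:ℝ)..(τ + σ), (τ + t - s) ^ (α - 1) • u s =
      (∫ s in (0:ℝ)..τ, (τ + t - s) ^ (α - 1) • u s) +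
      ∫ s in (0:ℝ)..σ, (t - s) ^ (α - 1) • u (τ + s) := by
  rw [← intervalIntegral.integral_add_adjacent_intervals
    (kern_smul_int hα (τ + t) le_rfl hτ hu) (kern_smul_int hα (τ + t) hτ (add_nonneg hτ hσ) hu)]
  congr 1
  have := intervalIntegral.integral_comp_add_left (a := 0) (b := σ)
    (fun s => (τ + t - s) ^ (α - 1) • u s) τ
  simp only [add_sub_add_left_eq_sub, add_zero] at this
  exact this.symm

section metric
variable {d : ℕ}

lemma supDist_nonneg (n : ℝ) (f h : ℝ → EuclideanSpace ℝ (Fin d)) : 0 ≤ supDist n f h :=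
  Real.iSup_nonneg fun _ => norm_nonneg _

lemma rhoN_nonneg (n : ℝ) (f h : ℝ → EuclideanSpace ℝ (Fin d)) : 0 ≤ rhoN n f h := by
  have := supDist_nonneg n f h
  unfold rhoN; positivity

lemma rhoN_le_one (n : ℝ) (f h : ℝ → EuclideanSpace ℝ (Fin d)) : rhoN n f h ≤ 1 := by
  have := supDist_nonneg n f h
  unfold rhoN; rw [div_le_one (by positivity)]; linarith

lemma rhoN_le (n : ℝ) (f h : ℝ → EuclideanSpace ℝ (Fin d)) : rhoN n f h ≤ supDist n f h := by
  have := supDist_nonneg n f h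
  unfold rhoN; exact div_le_self this (by linarith)

lemma hasSum_half : HasSum (fun n : ℕ => (1:ℝ) / 2 ^ (n + 1)) 1 := by
  convert hasSum_geometric_two' 1 using 2 with n
  rw [pow_succ]; field_simp

lemma term_le (f h : ℝ → EuclideanSpace ℝ (Fin d)) (n : ℕ) :
    (1 / 2 ^ (n + 1)) * rhoN ((n : ℝ) + 1) f h ≤ 1 / 2 ^ (n + 1) :=
  mul_le_of_le_one_right (by positivity) (rhoN_le_one _ _ _)

lemma term_nonneg (f h : ℝ → EuclideanSpace ℝ (Fin d)) (n : ℕ) :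
    0 ≤ (1 / 2 ^ (n + 1)) * rhoN ((n : ℝ) + 1) f h :=
  mul_nonneg (by positivity) (rhoN_nonneg _ _ _)

lemma rho_summable (f h : ℝ → EuclideanSpace ℝ (Fin d)) :
    Summable (fun n : ℕ => (1 / 2 ^ (n + 1)) * rhoN ((n : ℝ) + 1) f h) :=
  Summable.of_nonneg_of_le (term_nonneg f h) (term_le f h) hasSum_half.summable

lemma small_of_rho {η : ℝ} (hη : 0 < η) (P : ℕ) :
    ∃ δ : ℝ, 0 < δ ∧ ∀ f h : ℝ → EuclideanSpace ℝ (Fin d), ContinuousOn f (Ici 0) →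
      ContinuousOn h (Ici 0) → rhoMetric f h < δ →
      ∀ t ∈ Icc (0:ℝ) (P + 1), ‖f t - h t‖ ≤ η := by
  refine ⟨(1 / 2 ^ (P + 1)) * (η / (1 + η)), by positivity, fun f h hf hh hr t ht => ?_⟩
  have h1 : (1 / 2 ^ (P + 1)) * rhoN ((P : ℝ) + 1) f h ≤ rhoMetric f h :=
    (rho_summable f h).le_tsum P (fun n _ => term_nonneg f h n)
  have h2 : rhoN ((P : ℝ) + 1) f h < η / (1 + η) :=
    lt_of_mul_lt_mul_left (h1.trans_lt hr) (by positivity)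
  have h0 := supDist_nonneg ((P : ℝ) + 1) f h
  unfold rhoN at h2
  rw [div_lt_div_iff₀ (by positivity) (by positivity)] at h2
  have h3 : supDist ((P : ℝ) + 1) f h ≤ η := by nlinarith
  refine le_trans ?_ h3
  have hb : BddAbove (range fun t : Icc (0:ℝ) (P + 1) => ‖f t.1 - h t.1‖) := by
    have := isCompact_Icc.bddAbove_image
      (((hf.sub hh).norm).mono (fun s (hs : s ∈ Icc (0:ℝ) (P + 1)) => hs.1))
    rwa [image_eq_range] at this
  exact le_ciSup hb ⟨t, ht⟩

lemma rho_le_of_small {η : ℝ} (hη : 0 ≤ η) (N : ℕ) (f h : ℝ → EuclideanSpace ℝ (Fin d))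
    (hs : ∀ t ∈ Icc (0:ℝ) N, ‖f t - h t‖ ≤ η) : rhoMetric f h ≤ η + (1 / 2) ^ N := by
  unfold rhoMetric
  rw [← (rho_summable f h).sum_add_tsum_nat_add N]
  apply add_le_add
  · calc _ ≤ ∑ n ∈ Finset.range N, (1 / 2 ^ (n + 1)) * η := by
          apply Finset.sum_le_sum
          intro n hn
          gcongr
          refine (rhoN_le _ _ _).trans (Real.iSup_le (fun t => hs _ ⟨t.2.1, t.2.2.trans ?_⟩) hη)
          have := Finset.mem_range.1 hn
          exact_mod_cast this
      _ = (∑ n ∈ Finset.range N, (1:ℝ) / 2 ^ (n + 1)) * η := by rw [Finset.sum_mul]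
      _ ≤ 1 * η := by
          gcongr
          exact sum_le_hasSum _ (fun _ _ => by positivity) hasSum_half
      _ = η := one_mul _
  · have hS : HasSum (fun n : ℕ => (1:ℝ) / 2 ^ (n + N + 1)) ((1 / 2) ^ N) := by
      convert hasSum_half.mul_left ((1 / 2 : ℝ) ^ N) using 1
      · rfl
      · funext n
        rw [one_div_pow, one_div_mul_one_div, ← pow_add]
        congr 2
        ring
      · rw [mul_one]
    rw [← hS.tsum_eq]
    exact Summable.tsum_le_tsum (fun n => term_le f h (n + N))
      ((summable_nat_add_iff N).2 (rho_summable f h)) hS.summable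

end metric

/-- The autonomous Caputo FDE generates a semi-dynamical system on the space of
continuous functions `ℝ₊ → ℝ^d` with the topology of uniform convergence on
compact subsets. -/
theorem stmt13 {d : ℕ} (α : ℝ) (hα : α ∈ Set.Ioo (0:ℝ) 1)
    (g : EuclideanSpace ℝ (Fin d) → EuclideanSpace ℝ (Fin d))
    (L : ℝ) (hL : 0 < L)
    (hg : ∀ x y : EuclideanSpace ℝ (Fin d), ‖g x - g y‖ ≤ L * ‖x - y‖)
    (sol : (ℝ → EuclideanSpace ℝ (Fin d)) → ℝ → EuclideanSpace ℝ (Fin d))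
    (hsol : ∀ f : ℝ → EuclideanSpace ℝ (Fin d), ContinuousOn f (Set.Ici 0) →
      ContinuousOn (sol f) (Set.Ici 0) ∧
      ∀ t : ℝ, 0 ≤ t →
        sol f t = f t + (1 / Real.Gamma α) •
          ∫ s in (0:ℝ)..t, ((t - s) ^ (α - 1)) • g (sol f s)) :
    -- `T_τ` maps `𝔠` into `𝔠`
    (∀ τ : ℝ, 0 ≤ τ →
      ∀ f : ℝ → EuclideanSpace ℝ (Fin d), ContinuousOn f (Set.Ici 0) →
        ContinuousOn (semigroupOp α g sol τ f) (Set.Ici 0)) ∧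
    -- `T_τ : 𝔠 → 𝔠` is continuous with respect to the metric `ρ`
    (∀ τ : ℝ, 0 ≤ τ →
      ∀ f : ℝ → EuclideanSpace ℝ (Fin d), ContinuousOn f (Set.Ici 0) →
        ∀ ε : ℝ, 0 < ε → ∃ δ : ℝ, 0 < δ ∧
          ∀ h : ℝ → EuclideanSpace ℝ (Fin d), ContinuousOn h (Set.Ici 0) →
            rhoMetric f h < δ →
            rhoMetric (semigroupOp α g sol τ f) (semigroupOp α g sol τ h) < ε) ∧
    -- `T_0` is the identity on `𝔠`
    (∀ f : ℝ → EuclideanSpace ℝ (Fin d), ContinuousOn f (Set.Ici 0) →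
      ∀ θ : ℝ, 0 ≤ θ → semigroupOp α g sol 0 f θ = f θ) ∧
    -- the semigroup property `T_{σ+τ} = T_σ ∘ T_τ`
    (∀ σ τ : ℝ, 0 ≤ σ → 0 ≤ τ →
      ∀ f : ℝ → EuclideanSpace ℝ (Fin d), ContinuousOn f (Set.Ici 0) →
        ∀ θ : ℝ, 0 ≤ θ →
          semigroupOp α g sol (σ + τ) f θ =
            semigroupOp α g sol σ (semigroupOp α g sol τ f) θ) := by
  obtain ⟨hα0, hα1⟩ := hα
  have hG : 0 < Real.Gamma α := Real.Gamma_pos_of_pos hα0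
  have hgc : Continuous g := by
    have : LipschitzWith (Real.toNNReal L) g := LipschitzWith.of_dist_le_mul fun x y => by
      rw [dist_eq_norm, dist_eq_norm, Real.coe_toNNReal _ hL.le]; exact hg x y
    exact this.continuous
  have hshift : ∀ τ : ℝ, 0 ≤ τ → ∀ u : ℝ → EuclideanSpace ℝ (Fin d), ContinuousOn u (Ici 0) →
      ContinuousOn (fun θ => u (τ + θ)) (Ici 0) := fun τ hτ u hu =>
    hu.comp (by fun_prop) (fun θ hθ => add_nonneg hτ hθ)
  have hmap : ∀ τ : ℝ, 0 ≤ τ →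
      ∀ f : ℝ → EuclideanSpace ℝ (Fin d), ContinuousOn f (Set.Ici 0) →
        ContinuousOn (semigroupOp α g sol τ f) (Set.Ici 0) := by
    intro τ hτ f hf
    have h1 := cont_op (u := fun s => g (sol f s)) hα0 hα1 hτ
      (hgc.comp_continuousOn (hsol f hf).1)
    exact (hshift τ hτ f hf).add (h1.const_smul (1 / Real.Gamma α))
  refine ⟨hmap, ?_, ?_, ?_⟩
  · intro τ hτ f hf ε hε
    obtain ⟨N, hN⟩ := exists_pow_lt_of_lt_one (half_pos hε) (by norm_num : (1 / 2 : ℝ) < 1)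
    obtain ⟨P, hP⟩ := exists_nat_ge (τ + N)
    set K := ∫ s in (0:ℝ)..τ, (τ - s) ^ (α - 1) with hK
    have hK0 : 0 ≤ K := intervalIntegral.integral_nonneg hτ
      fun s hs => rpow_nonneg (by linarith [hs.2]) _
    set C := 1 + (1 / Real.Gamma α) * (K * (L * (2 * exp ((2 * L) ^ (1 / α) * τ)))) with hC
    have hC0 : 0 < C := by positivity
    obtain ⟨δ, hδ, H⟩ := small_of_rho (d := d) (η := ε / 2 / C) (by positivity) P
    refine ⟨δ, hδ, fun h hh hr => ?_⟩
    have H1 := H f h hf hh hr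
    set η := ε / 2 / C with hη
    have hη0 : 0 < η := by positivity
    have H2 := stab hα0 hL (by positivity) hgc hg (hsol f hf).1 (hsol h hh).1 (hsol f hf).2
      (hsol h hh).2 H1
    have H3 := rho_le_of_small (η := ε / 2) (by positivity) N
      (semigroupOp α g sol τ f) (semigroupOp α g sol τ h) ?_
    · linarith
    intro θ hθ
    have e1 : ‖f (τ + θ) - h (τ + θ)‖ ≤ η :=
      H1 _ ⟨add_nonneg hτ hθ.1, by linarith [hθ.2]⟩
    have e2 := diff_bound hα0 hgc hg (hsol f hf).1 (hsol h hh).1 hτ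
      (show τ ≤ τ + θ by linarith [hθ.1])
    have e3 : ∫ s in (0:ℝ)..τ, (τ + θ - s) ^ (α - 1) * (L * ‖sol f s - sol h s‖) ≤
        ∫ s in (0:ℝ)..τ, (τ - s) ^ (α - 1) * (L * (2 * η * exp ((2 * L) ^ (1 / α) * τ))) := by
      apply intervalIntegral.integral_mono_on_of_le_Ioo hτ
      · exact kern_smul_int (E := ℝ) hα0 _ le_rfl hτ
          (((hsol f hf).1.sub (hsol h hh).1).norm.const_smul L)
      · exact (kern_int hα0 _ _ _).mul_const _
      · intro s hs
        have k1 : (τ + θ - s) ^ (α - 1) ≤ (τ - s) ^ (α - 1) :=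
          rpow_le_rpow_of_nonpos (by linarith [hs.2]) (by linarith [hθ.1]) (by linarith)
        have k2 : ‖sol f s - sol h s‖ ≤ 2 * η * exp ((2 * L) ^ (1 / α) * τ) := by
          refine (H2 s ⟨hs.1.le, ?_⟩).trans ?_
          · have : (0:ℝ) ≤ N := by positivity
            linarith [hs.2]
          · have := hs.2.le
            gcongr
        have k3 : 0 ≤ (τ - s) ^ (α - 1) := rpow_nonneg (by linarith [hs.2]) _
        gcongr
    rw [intervalIntegral.integral_mul_const, ← hK] at e3
    unfold semigroupOp
    rw [add_sub_add_comm, ← smul_sub]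
    calc _ ≤ _ := norm_add_le _ _
      _ ≤ η + (1 / Real.Gamma α) * (K * (L * (2 * η * exp ((2 * L) ^ (1 / α) * τ)))) := by
          apply add_le_add e1
          rw [norm_smul, Real.norm_of_nonneg (by positivity)]
          gcongr
          exact e2.trans e3
      _ = C * η := by rw [hC]; ring
      _ = ε / 2 := by rw [hη]; field_simp
  · intro f hf θ hθ
    simp [semigroupOp]
  · intro σ τ hσ hτ f hf θ hθ
    have hT := hmap τ hτ f hf
    have hgu := hgc.comp_continuousOn (hsol f hf).1
    have hy : ∀ t : ℝ, 0 ≤ t → sol f (τ + t) = semigroupOp α g sol τ f t +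
        (1 / Real.Gamma α) • ∫ s in (0:ℝ)..t, ((t - s) ^ (α - 1)) • g (sol f (τ + s)) := by
      intro t ht
      rw [(hsol f hf).2 (τ + t) (add_nonneg hτ ht)]
      have := split_int (t := t) hα0 hτ ht hgu
      simp only [Function.comp_apply] at this
      rw [this, smul_add, ← add_assoc]
      rfl
    have huniq : ∀ t : ℝ, 0 ≤ t → sol (semigroupOp α g sol τ f) t = sol f (τ + t) := by
      intro t ht
      have := stab (a := 0) hα0 hL ht hgc hg (hsol _ hT).1 (hshift τ hτ _ (hsol f hf).1)
        (hsol _ hT).2 hy (by intro s _; simp) t ⟨ht, le_rfl⟩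
      simp only [mul_zero, zero_mul] at this
      exact sub_eq_zero.1 (norm_le_zero_iff.1 this)
    have h1 : ∫ s in (0:ℝ)..σ, ((σ + θ - s) ^ (α - 1)) • g (sol (semigroupOp α g sol τ f) s) =
        ∫ s in (0:ℝ)..σ, ((σ + θ - s) ^ (α - 1)) • g (sol f (τ + s)) := by
      apply intervalIntegral.integral_congr
      intro s hs
      rw [uIcc_of_le hσ] at hs
      simp only [huniq s hs.1]
    have h2 := split_int (t := σ + θ) hα0 hτ hσ hgu
    simp only [Function.comp_apply] at h2
    conv_rhs => unfold semigroupOp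
    change _ = semigroupOp α g sol τ f (σ + θ) + (1 / Real.Gamma α) •
      ∫ s in (0:ℝ)..σ, ((σ + θ - s) ^ (α - 1)) • g (sol (semigroupOp α g sol τ f) s)
    rw [h1]
    unfold semigroupOp
    rw [add_comm σ τ, add_assoc τ σ θ, h2, smul_add, ← add_assoc]
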